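/- With the notation above, let Δ_n = A_n + S_n = a_n + a_nᵀ + s_n + s_nᵀ be the combinatorial Laplacian (Hecke-type operator) of the Fabrykowski–Gupta group acting on {0,1,2}^n. Then the set of real eigenvalues of Δ₀ is {4}; the set of eigenvalues of Δ₁ is {1,4}; and for every n ≥ 2 the set of eigenvalues of Δ_n equals {1,4} ∪ ⋃_{m=2}^{n} {1 + √(5−θ), 1 − √(5−θ) : θ ∈ X_m}, where X₂ = {−1} and X_m = {θ ∈ ℝ : 4 − 2θ − θ² ∈ X_{m−1}} for m ≥ 3. -/

import Mathlib

open Matrix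

/-- The level-`n` action of the generator `a` of the Fabrykowski–Gupta group on ternary
words of length `n`: `a_n(xv) = ((x+1) mod 3)·v`, `a₀ = id`. -/
def fgA : (n : ℕ) → (Fin n → Fin 3) → (Fin n → Fin 3)
  | 0, v => v
  | _ + 1, v => Fin.cons (v 0 + 1) (Fin.tail v)

/-- The level-`n` action of the generator `s` of the Fabrykowski–Gupta group:
`s_n(0v) = 0·a_{n−1}(v)`, `s_n(1v) = 1·v`, `s_n(2v) = 2·s_{n−1}(v)`, `s₀ = id`. -/
def fgS : (n : ℕ) → (Fin n → Fin 3) → (Fin n → Fin 3)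
  | 0, v => v
  | n + 1, v =>
    if v 0 = 0 then Fin.cons 0 (fgA n (Fin.tail v))
    else if v 0 = 2 then Fin.cons 2 (fgS n (Fin.tail v))
    else v

/-- The real permutation matrix of a map `f` of a finite set. -/
def permMat {I : Type*} [Fintype I] [DecidableEq I] (f : I → I) : Matrix I I ℝ :=
  Matrix.of fun i j => if f j = i then 1 else 0

/-- The combinatorial Laplacian (Hecke type operator)
`Δ_n = a_n + a_nᵀ + s_n + s_nᵀ` of the Fabrykowski–Gupta group at level `n`. -/
noncomputable def fgDelta (n : ℕ) : Matrix (Fin n → Fin 3) (Fin n → Fin 3) ℝ :=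
  permMat (fgA n) + (permMat (fgA n))ᵀ + permMat (fgS n) + (permMat (fgS n))ᵀ

/-- The preimage sets `X_m`: `X₂ = {−1}`, `X_m = F⁻¹(X_{m−1})` for `m ≥ 3`, where
`F(θ) = 4 − 2θ − θ²`. (`X₀`, `X₁` are irrelevant and set to `∅`.) -/
def Xset : ℕ → Set ℝ
  | 0 => ∅
  | 1 => ∅
  | 2 => {-1}
  | m + 3 => {θ : ℝ | (4 - 2 * θ - θ ^ 2) ∈ Xset (m + 2)}

open scoped Kronecker

/-- The self-adjoint operator `a_n + a_nᵀ`. -/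
noncomputable def fgAdjA (n : ℕ) : Matrix (Fin n → Fin 3) (Fin n → Fin 3) ℝ :=
  permMat (fgA n) + (permMat (fgA n))ᵀ

/-- The self-adjoint operator `s_n + s_nᵀ`. -/
noncomputable def fgAdjS (n : ℕ) : Matrix (Fin n → Fin 3) (Fin n → Fin 3) ℝ :=
  permMat (fgS n) + (permMat (fgS n))ᵀ

/-- The two-parameter pencil `S_n + l A_n - m`. -/
noncomputable def fgPencil (n : ℕ) (l m : ℝ) : Matrix (Fin n → Fin 3) (Fin n → Fin 3) ℝ :=
  fgAdjS n + l • fgAdjA n - m • 1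

/-- Words of length `n + 1` grouped by their first letter. -/
noncomputable def wordSumEquiv (n : ℕ) :
    ((Fin n → Fin 3) ⊕ (Fin n → Fin 3)) ⊕ (Fin n → Fin 3) ≃ (Fin (n + 1) → Fin 3) :=
  Equiv.ofBijective
    (Sum.elim (Sum.elim (fun v => Fin.cons 0 v) (fun v => Fin.cons 1 v)) (fun v => Fin.cons 2 v))
    (by
      constructor
      · rintro ((v | v) | v) ((w | w) | w) h <;> simp [Fin.cons_inj] at h ⊢ <;> exact h
      · intro v
        rw [← Fin.cons_self_tail v]
        generalize v 0 = x
        fin_cases x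
        · exact ⟨Sum.inl (Sum.inl (Fin.tail v)), rfl⟩
        · exact ⟨Sum.inl (Sum.inr (Fin.tail v)), rfl⟩
        · exact ⟨Sum.inr (Fin.tail v), rfl⟩)

theorem wordSumEquiv_inl_inl (n : ℕ) (v : Fin n → Fin 3) :
    wordSumEquiv n (Sum.inl (Sum.inl v)) = (Fin.cons 0 v : Fin (n + 1) → Fin 3) := rfl

theorem wordSumEquiv_inl_inr (n : ℕ) (v : Fin n → Fin 3) :
    wordSumEquiv n (Sum.inl (Sum.inr v)) = (Fin.cons 1 v : Fin (n + 1) → Fin 3) := rfl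

theorem wordSumEquiv_inr (n : ℕ) (v : Fin n → Fin 3) :
    wordSumEquiv n (Sum.inr v) = (Fin.cons 2 v : Fin (n + 1) → Fin 3) := rfl

/-- The adjacency matrix of the triangle. -/
def triangleMat : Matrix (Fin 3) (Fin 3) ℝ :=
  Matrix.of fun x y => if x = y then 0 else 1

theorem fgAdjA_succ_apply (n : ℕ) (x y : Fin 3) (v w : Fin n → Fin 3) :
    fgAdjA (n + 1) (Fin.cons x v) (Fin.cons y w) =
      triangleMat x y * (1 : Matrix (Fin n → Fin 3) (Fin n → Fin 3) ℝ) v w := by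
  simp only [fgAdjA, permMat, fgA, Matrix.add_apply, Matrix.transpose_apply, Matrix.of_apply,
    Fin.cons_zero, Fin.tail_cons, Fin.cons_inj, Matrix.one_apply, eq_comm (a := w)]
  by_cases h : v = w <;> fin_cases x <;> fin_cases y <;> simp [h, triangleMat]

theorem fgAdjA_succ (n : ℕ) :
    (fgAdjA (n + 1)).submatrix (Fin.consEquiv fun _ => Fin 3) (Fin.consEquiv fun _ => Fin 3) =
      triangleMat ⊗ₖ (1 : Matrix (Fin n → Fin 3) (Fin n → Fin 3) ℝ) := by
  ext ⟨x, v⟩ ⟨y, w⟩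
  exact fgAdjA_succ_apply n x y v w

theorem fgAdjA_succ_mul_self (n : ℕ) :
    fgAdjA (n + 1) * fgAdjA (n + 1) = fgAdjA (n + 1) + (2 : ℝ) • 1 := by
  have hT : triangleMat * triangleMat = triangleMat + (2 : ℝ) • 1 := by
    ext i j
    simp only [triangleMat, Matrix.mul_apply, Fin.sum_univ_three, Matrix.of_apply,
      Matrix.add_apply, Matrix.smul_apply, Matrix.one_apply, smul_eq_mul]
    fin_cases i <;> fin_cases j <;> simp +decide <;> norm_num
  have hinj := (Matrix.reindex (α := ℝ) (Fin.consEquiv fun _ : Fin (n + 1) => Fin 3).symm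
    (Fin.consEquiv fun _ : Fin (n + 1) => Fin 3).symm).injective
  apply hinj
  simp only [Matrix.reindex_apply, Equiv.symm_symm]
  rw [← Matrix.submatrix_mul_equiv _ _ _ (Fin.consEquiv fun _ : Fin (n + 1) => Fin 3) _,
    Matrix.submatrix_add, Pi.add_apply, Pi.add_apply, Matrix.submatrix_smul, Pi.smul_apply,
    Pi.smul_apply, Matrix.submatrix_one_equiv, fgAdjA_succ, ← Matrix.mul_kronecker_mul, hT,
    Matrix.add_kronecker, Matrix.smul_kronecker, one_mul, Matrix.one_kronecker_one]

theorem det_smul_one_add_smul_fgAdjA (n : ℕ) (x y : ℝ) :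
    (x • (1 : Matrix _ _ ℝ) + y • fgAdjA (n + 1)).det =
      (x + 2 * y) ^ 3 ^ n * ((x - y) ^ 2) ^ 3 ^ n := by
  rw [← Matrix.det_submatrix_equiv_self (Fin.consEquiv fun _ : Fin (n + 1) => Fin 3),
    Matrix.submatrix_add, Pi.add_apply, Pi.add_apply, Matrix.submatrix_smul, Matrix.submatrix_smul]
  simp only [Pi.smul_apply]
  rw [Matrix.submatrix_one_equiv, fgAdjA_succ,
    ← Matrix.one_kronecker_one, ← Matrix.smul_kronecker, ← Matrix.smul_kronecker,
    ← Matrix.add_kronecker, Matrix.det_kronecker, Matrix.det_one, one_pow, mul_one,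
    ← mul_pow]
  congr 1
  · rw [Matrix.det_fin_three]
    simp [triangleMat]
    ring
  · simp

theorem fgAdjS_succ_submatrix (n : ℕ) :
    (fgAdjS (n + 1)).submatrix (wordSumEquiv n) (wordSumEquiv n) =
      Matrix.fromBlocks (Matrix.fromBlocks (fgAdjA n) 0 0 ((2 : ℝ) • 1)) 0 0 (fgAdjS n) := by
  ext ((v | v) | v) ((w | w) | w) <;>
    simp [wordSumEquiv_inl_inl, wordSumEquiv_inl_inr, wordSumEquiv_inr, fgAdjS, fgAdjA, permMat,
      fgS, Fin.cons_inj, Matrix.one_apply, eq_comm (a := w)]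
  split_ifs <;> norm_num

theorem fgAdjA_succ_submatrix (n : ℕ) :
    (fgAdjA (n + 1)).submatrix (wordSumEquiv n) (wordSumEquiv n) =
      Matrix.fromBlocks (Matrix.fromBlocks 0 1 1 0) (Matrix.fromRows 1 1)
        (Matrix.fromCols 1 1) 0 := by
  ext ((v | v) | v) ((w | w) | w) <;>
    simp [wordSumEquiv_inl_inl, wordSumEquiv_inl_inr, wordSumEquiv_inr, fgAdjA_succ_apply,
      triangleMat]

theorem fgPencil_succ_submatrix (n : ℕ) (l m : ℝ) :
    (fgPencil (n + 1) l m).submatrix (wordSumEquiv n) (wordSumEquiv n) =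
      Matrix.fromBlocks
        (Matrix.fromBlocks (fgAdjA n - m • 1) (l • 1) (l • 1) ((2 - m) • 1))
        (Matrix.fromRows (l • 1) (l • 1)) (Matrix.fromCols (l • 1) (l • 1))
        (fgAdjS n - m • 1) := by
  have : (fgPencil (n + 1) l m).submatrix (wordSumEquiv n) (wordSumEquiv n) =
      (fgAdjS (n + 1)).submatrix (wordSumEquiv n) (wordSumEquiv n) +
        l • (fgAdjA (n + 1)).submatrix (wordSumEquiv n) (wordSumEquiv n) -
        m • (1 : Matrix _ _ ℝ).submatrix (wordSumEquiv n) (wordSumEquiv n) := rfl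
  rw [this, fgAdjS_succ_submatrix, fgAdjA_succ_submatrix, Matrix.submatrix_one_equiv]
  ext ((v | v) | v) ((w | w) | w) <;> simp [Matrix.one_apply]
  split_ifs <;> ring

theorem det_fgPencil_succ_succ (n : ℕ) {l m : ℝ} (h₀ : m - 2 ≠ 0) (h₁ : m - 2 - l ≠ 0)
    (h₂ : (m + 1) * (m - 2) - l ^ 2 ≠ 0) :
    (fgPencil (n + 2) l m).det =
      ((m - 2 - l) * (m - 2 + l)) ^ 3 ^ n * (((m + 1) * (m - 2) - l ^ 2) ^ 2) ^ 3 ^ n *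
        (fgPencil (n + 1)
          ((m - 2 + l) / ((m - 2 - l) * ((m + 1) * (m - 2) - l ^ 2)) * l ^ 2)
          (m - 2 * l ^ 2 / (m - 2 - l) +
            2 * ((m - 2 + l) / ((m - 2 - l) * ((m + 1) * (m - 2) - l ^ 2)) * l ^ 2))).det := by
  set A := fgAdjA (n + 1) with hA
  have hAA : A * A = A + (2 : ℝ) • 1 := fgAdjA_succ_mul_self n
  set X : Matrix ((Fin (n + 1) → Fin 3) ⊕ (Fin (n + 1) → Fin 3))
      ((Fin (n + 1) → Fin 3) ⊕ (Fin (n + 1) → Fin 3)) ℝ :=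
    Matrix.fromBlocks (A - m • 1) (l • 1) (l • 1) ((2 - m) • 1) with hX
  have hdetX : X.det = ((m - 2 - l) * (m - 2 + l)) ^ 3 ^ n *
      (((m + 1) * (m - 2) - l ^ 2) ^ 2) ^ 3 ^ n := by
    have hmul : X * Matrix.fromBlocks 1 0 ((l / (m - 2)) • 1) 1 =
        Matrix.fromBlocks ((-m + l ^ 2 / (m - 2)) • 1 + (1 : ℝ) • A) (l • 1) 0
          ((2 - m) • 1) := by
      rw [hX, Matrix.fromBlocks_multiply]
      congr 1
      · simp only [Matrix.mul_one, smul_mul_smul_comm]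
        module
      · simp
      · simp only [Matrix.mul_one, smul_mul_smul_comm, ← add_smul]
        rw [show l + (2 - m) * (l / (m - 2)) = 0 by field_simp; ring, zero_smul]
      · simp
    have hdet := congrArg Matrix.det hmul
    rw [Matrix.det_mul, Matrix.det_fromBlocks_zero₁₂, Matrix.det_fromBlocks_zero₂₁,
      det_smul_one_add_smul_fgAdjA, Matrix.det_smul, Matrix.det_one] at hdet
    simp only [mul_one, Fintype.card_fun, Fintype.card_fin, pow_succ 3 n, mul_comm (3 ^ n) 3,
      pow_mul, ← mul_pow] at hdet
    rw [hdet, ← mul_pow]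
    congr 1
    field_simp
    ring
  set D := (m + 1) * (m - 2) - l ^ 2 with hD
  set b := l * (m - 2) / ((m - 2 - l) * D) with hb
  set a := l / (m - 2 - l) - 2 * b with ha
  set R₀ : Matrix (Fin (n + 1) → Fin 3) (Fin (n + 1) → Fin 3) ℝ := a • 1 + b • A with hR₀
  set R₁ : Matrix (Fin (n + 1) → Fin 3) (Fin (n + 1) → Fin 3) ℝ :=
    (l / (m - 2) * (1 + a)) • 1 + (l / (m - 2) * b) • A with hR₁
  have hred : (fgPencil (n + 2) l m).submatrix (wordSumEquiv (n + 1)) (wordSumEquiv (n + 1)) *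
      Matrix.fromBlocks 1 (Matrix.fromRows R₀ R₁) 0 1 =
      Matrix.fromBlocks X 0 (Matrix.fromCols (l • 1) (l • 1))
        (fgPencil (n + 1) ((m - 2 + l) / ((m - 2 - l) * D) * l ^ 2)
          (m - 2 * l ^ 2 / (m - 2 - l) + 2 * ((m - 2 + l) / ((m - 2 - l) * D) * l ^ 2))) := by
    rw [fgPencil_succ_submatrix, Matrix.fromBlocks_multiply]
    congr 1
    · simp [hX, hA]
    · rw [Matrix.fromBlocks_mul_fromRows, Matrix.mul_one]
      ext (i | i) j
      · simp only [Matrix.add_apply, Matrix.fromRows_apply_inl, Matrix.zero_apply]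
        rw [← hA, hR₀, hR₁]
        have : (A - m • 1) * (a • 1 + b • A) +
            (l • 1) * ((l / (m - 2) * (1 + a)) • 1 + (l / (m - 2) * b) • A) + l • 1 = 0 := by
          simp only [sub_mul, mul_add, smul_mul_assoc, mul_smul_comm, one_mul, mul_one, hAA]
          have e₁ : 2 * b - m * a + l * (l / (m - 2) * (1 + a)) + l = 0 := by
            rw [ha, hb]
            field_simp
            rw [hD]
            ring
          have e₂ : a + b - m * b + l * (l / (m - 2) * b) = 0 := by
            rw [ha, hb]
            field_simp
            rw [hD]
            ring
          linear_combination (norm := module)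
            e₁ • (1 : Matrix (Fin (n + 1) → Fin 3) (Fin (n + 1) → Fin 3) ℝ) + e₂ • A
        exact congrFun (congrFun this i) j
      · simp only [Matrix.add_apply, Matrix.fromRows_apply_inr, Matrix.zero_apply]
        rw [hR₀, hR₁]
        have : (l • 1) * (a • 1 + b • A) +
            ((2 - m) • 1) * ((l / (m - 2) * (1 + a)) • 1 + (l / (m - 2) * b) • A) + l • 1 = 0 := by
          simp only [mul_add, smul_mul_assoc, mul_smul_comm, one_mul, mul_one]
          have e₁ : l * a + (2 - m) * (l / (m - 2) * (1 + a)) + l = 0 := by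
            field_simp
            ring
          have e₂ : l * b + (2 - m) * (l / (m - 2) * b) = 0 := by
            field_simp
            ring
          linear_combination (norm := module)
            e₁ • (1 : Matrix (Fin (n + 1) → Fin 3) (Fin (n + 1) → Fin 3) ℝ) + e₂ • A
        exact congrFun (congrFun this i) j
    · simp
    · rw [Matrix.fromCols_mul_fromRows, Matrix.mul_one, fgPencil, ← hA, hR₀, hR₁]
      simp only [mul_add, smul_mul_assoc, mul_smul_comm, one_mul, mul_one]
      have e₁ : l * a + l * (l / (m - 2) * (1 + a)) - m =
          -(m - 2 * l ^ 2 / (m - 2 - l) + 2 * ((m - 2 + l) / ((m - 2 - l) * D) * l ^ 2)) := by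
        rw [ha, hb]
        field_simp
        ring
      have e₂ : l * b + l * (l / (m - 2) * b) = (m - 2 + l) / ((m - 2 - l) * D) * l ^ 2 := by
        rw [hb]
        field_simp
      linear_combination (norm := module)
        e₁ • (1 : Matrix (Fin (n + 1) → Fin 3) (Fin (n + 1) → Fin 3) ℝ) + e₂ • A
  have hdet := congrArg Matrix.det hred
  rw [Matrix.det_mul, Matrix.det_submatrix_equiv_self, Matrix.det_fromBlocks_zero₂₁,
    Matrix.det_fromBlocks_zero₁₂, Matrix.det_one, Matrix.det_one, mul_one, mul_one, hdetX] at hdet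
  exact hdet

/-- The homogenised product of the iterates of `θ ↦ 4 - 2θ - θ²` (at `θ = -h / l`) which gives
the nontrivial part of the determinant of the pencil. -/
def iterateProd : ℕ → ℝ → ℝ → ℝ
  | 0, _, _ => 1
  | n + 1, h, l => (h - l) ^ (3 ^ n + 1) * iterateProd n (h ^ 2 - 2 * l * h - 4 * l ^ 2) (l ^ 2)

theorem mul_iterateProd_mul (n : ℕ) (c h l : ℝ) :
    c * iterateProd n (c * h) (c * l) = c ^ 3 ^ n * iterateProd n h l := by
  induction n generalizing c h l with
  | zero => simp [iterateProd]
  | succ n ih =>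
    have := ih (c ^ 2) (h ^ 2 - 2 * l * h - 4 * l ^ 2) (l ^ 2)
    simp only [iterateProd]
    rw [show (c * h) ^ 2 - 2 * (c * l) * (c * h) - 4 * (c * l) ^ 2 =
      c ^ 2 * (h ^ 2 - 2 * l * h - 4 * l ^ 2) by ring, mul_pow c l 2,
      show c * h - c * l = c * (h - l) by ring, mul_pow c (h - l)]
    generalize h - l = d
    calc _ = c ^ 3 ^ n * d ^ (3 ^ n + 1) * (c ^ 2 *
          iterateProd n (c ^ 2 * (h ^ 2 - 2 * l * h - 4 * l ^ 2)) (c ^ 2 * l ^ 2)) := by ring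
      _ = _ := by
        rw [this]
        ring

theorem continuous_iterateProd (n : ℕ) :
    Continuous fun p : ℝ × ℝ => iterateProd n p.1 p.2 := by
  induction n with
  | zero => exact continuous_const
  | succ n ih =>
    have h : Continuous fun p : ℝ × ℝ => (p.1 ^ 2 - 2 * p.2 * p.1 - 4 * p.2 ^ 2, p.2 ^ 2) := by
      fun_prop
    have h' := ih.comp h
    simp only [iterateProd]
    exact Continuous.mul (by fun_prop) h'

theorem continuous_det_fgPencil (n : ℕ) (l : ℝ) :
    Continuous fun m => (fgPencil n l m).det := by
  apply Continuous.matrix_det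
  unfold fgPencil
  fun_prop

theorem dense_generic (l : ℝ) :
    Dense {m : ℝ | m - 2 ≠ 0 ∧ m - 2 - l ≠ 0 ∧ (m + 1) * (m - 2) - l ^ 2 ≠ 0} := by
  have hfin : {m : ℝ | m - 2 ≠ 0 ∧ m - 2 - l ≠ 0 ∧ (m + 1) * (m - 2) - l ^ 2 ≠ 0}ᶜ.Finite := by
    refine Set.Finite.subset (s := {2, 2 + l, 1 / 2 + √(9 / 4 + l ^ 2), 1 / 2 - √(9 / 4 + l ^ 2)})
      (by simp) ?_
    intro m hm
    simp only [Set.mem_compl_iff, Set.mem_ofPred_eq, not_and_or, not_not] at hm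
    simp only [Set.mem_insert_iff, Set.mem_singleton_iff]
    rcases hm with hm | hm | hm
    · left; linarith
    · right; left; linarith
    · right; right
      have hsq := Real.sq_sqrt (show 0 ≤ 9 / 4 + l ^ 2 by positivity)
      have : (m - (1 / 2 + √(9 / 4 + l ^ 2))) * (m - (1 / 2 - √(9 / 4 + l ^ 2))) = 0 := by
        linear_combination hm - hsq
      rcases mul_eq_zero.mp this with h | h
      · left; linarith
      · right; linarith
  simpa using hfin.countable.dense_compl ℝ

theorem det_fgPencil_succ (n : ℕ) (l m : ℝ) :
    (fgPencil (n + 1) l m).det = (2 + 2 * l - m) * (2 - l - m) ^ (3 ^ n + 1) *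
      iterateProd n (m ^ 2 - l * m - 2 * l ^ 2 - 2 - m) l := by
  induction n generalizing l m with
  | zero =>
    have hS : fgAdjS 1 = (2 : ℝ) • 1 := by
      ext v w
      have hfg : fgS 1 = id := by
        funext v
        refine (Fin.cons_self_tail (fgS 1 v)).symm.trans ?_
        funext i
        fin_cases i
        simp [fgS]
        split_ifs <;> simp_all
      simp only [fgAdjS, permMat, hfg, Matrix.add_apply, Matrix.transpose_apply, Matrix.of_apply,
        Matrix.smul_apply, Matrix.one_apply, id, eq_comm (a := w), smul_eq_mul]
      split_ifs <;> norm_num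
    have h := det_smul_one_add_smul_fgAdjA 0 (2 - m) l
    rw [fgPencil, hS, show (2 : ℝ) • (1 : Matrix (Fin 1 → Fin 3) _ ℝ) + l • fgAdjA (0 + 1) - m • 1
      = (2 - m) • 1 + l • fgAdjA (0 + 1) by module, h]
    simp only [iterateProd, pow_zero]
    ring
  | succ n ih =>
    refine congrFun (Continuous.ext_on (dense_generic l) (continuous_det_fgPencil (n + 2) l)
      (g := fun m => (2 + 2 * l - m) * (2 - l - m) ^ (3 ^ (n + 1) + 1) *
      iterateProd (n + 1) (m ^ 2 - l * m - 2 * l ^ 2 - 2 - m) l) ?_ ?_) m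
    · have := (continuous_iterateProd (n + 1)).comp
        (show Continuous fun m : ℝ => (m ^ 2 - l * m - 2 * l ^ 2 - 2 - m, l) by fun_prop)
      exact Continuous.mul (by fun_prop) this
    · rintro m ⟨h₀, h₁, h₂⟩
      simp only [det_fgPencil_succ_succ n h₀ h₁ h₂, ih]
      clear ih
      set D := (m + 1) * (m - 2) - l ^ 2 with hD
      set c := (m - 2 + l) / ((m - 2 - l) * D) with hc
      set h := m ^ 2 - l * m - 2 * l ^ 2 - 2 - m with hh
      set m' := m - 2 * l ^ 2 / (m - 2 - l) + 2 * (c * l ^ 2) with hm'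
      have hH : m' ^ 2 - c * l ^ 2 * m' - 2 * (c * l ^ 2) ^ 2 - 2 - m' =
          c * (h ^ 2 - 2 * l * h - 4 * l ^ 2) := by
        rw [hm', hc, hh]
        field_simp
        rw [hD]
        ring
      have huv : (2 + 2 * (c * l ^ 2) - m') * (2 - c * l ^ 2 - m') =
          c * ((2 + 2 * l - m) * (2 - l - m) * (h - l)) := by
        rw [hm', hc, hh]
        field_simp
        rw [hD]
        ring
      have hv : (m - 2 - l) * (m - 2 + l) * D ^ 2 * (2 - c * l ^ 2 - m') * c =
          (2 - l - m) ^ 3 * (h - l) := by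
        rw [hm', hc, hh]
        field_simp
        rw [hD]
        ring
      rw [hH]
      simp only [iterateProd]
      generalize 2 - c * l ^ 2 - m' = v' at *
      generalize 2 + 2 * (c * l ^ 2) - m' = u' at *
      generalize h ^ 2 - 2 * l * h - 4 * l ^ 2 = H at *
      generalize h - l = d at *
      generalize 2 + 2 * l - m = u at *
      generalize 2 - l - m = v at *
      generalize (m - 2 - l) * (m - 2 + l) = E at *
      calc _ = (E * D ^ 2 * v') ^ 3 ^ n * (u' * v') *
            iterateProd n (c * H) (c * l ^ 2) := by ring_nf
        _ = (E * D ^ 2 * v') ^ 3 ^ n *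
            (u * v * d) *
            (c * iterateProd n (c * H) (c * l ^ 2)) := by
          rw [huv]
          ring
        _ = (E * D ^ 2 * v' * c) ^ 3 ^ n *
            (u * v * d) * iterateProd n H (l ^ 2) := by
          rw [mul_iterateProd_mul]
          ring_nf
        _ = _ := by
          rw [hv]
          ring

theorem iterateProd_one_eq_zero_iff (n : ℕ) (h : ℝ) :
    iterateProd n h 1 = 0 ↔ ∃ m : ℕ, 2 ≤ m ∧ m ≤ n + 1 ∧ -h ∈ Xset m := by
  induction n generalizing h with
  | zero =>
    simp only [iterateProd, one_ne_zero, false_iff]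
    rintro ⟨m, hm, hm', -⟩
    omega
  | succ n ih =>
    have hsucc : ∀ m, -h ∈ Xset (m + 3) ↔ -(h ^ 2 - 2 * 1 * h - 4 * 1 ^ 2) ∈ Xset (m + 2) := by
      intro m
      rw [Xset, Set.mem_ofPred_eq]
      ring_nf
    have h2 : -h ∈ Xset 2 ↔ h = 1 := by
      simp [Xset]
    have key := ih (h ^ 2 - 2 * 1 * h - 4 * 1 ^ 2)
    simp only [iterateProd, mul_eq_zero, pow_eq_zero_iff (Nat.succ_ne_zero _), sub_eq_zero]
    rw [one_pow] at *
    rw [key]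
    constructor
    · rintro (rfl | ⟨m, hm, hm', hX⟩)
      · exact ⟨2, le_rfl, by omega, h2.mpr rfl⟩
      · obtain ⟨k, rfl⟩ := Nat.exists_eq_add_of_le' hm
        exact ⟨k + 3, by omega, by omega, (hsucc k).mpr (by simpa using hX)⟩
    · rintro ⟨m, hm, hm', hX⟩
      obtain ⟨k, rfl⟩ := Nat.exists_eq_add_of_le' hm
      cases k with
      | zero => exact Or.inl (h2.mp hX)
      | succ k => exact Or.inr ⟨k + 2, by omega, by omega, by simpa using (hsucc k).mp hX⟩

theorem mem_spectrum_fgDelta_iff (n : ℕ) (x : ℝ) :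
    x ∈ spectrum ℝ (fgDelta n) ↔ (fgPencil n 1 x).det = 0 := by
  have : algebraMap ℝ _ x - fgDelta n = -fgPencil n 1 x := by
    rw [fgDelta, fgPencil, fgAdjA, fgAdjS, Algebra.algebraMap_eq_smul_one]
    module
  rw [spectrum.mem_iff, this, IsUnit.neg_iff, Matrix.isUnit_iff_isUnit_det, isUnit_iff_ne_zero,
    not_not]

theorem mem_spectrum_fgDelta_succ_iff (n : ℕ) (x : ℝ) :
    x ∈ spectrum ℝ (fgDelta (n + 1)) ↔
      x = 1 ∨ x = 4 ∨ ∃ m : ℕ, 2 ≤ m ∧ m ≤ n + 1 ∧ 4 + 2 * x - x ^ 2 ∈ Xset m := by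
  rw [mem_spectrum_fgDelta_iff, det_fgPencil_succ, mul_eq_zero, mul_eq_zero,
    pow_eq_zero_iff (Nat.succ_ne_zero _), iterateProd_one_eq_zero_iff,
    show -(x ^ 2 - 1 * x - 2 * 1 ^ 2 - 2 - x) = 4 + 2 * x - x ^ 2 by ring,
    or_comm (a := 2 + 2 * 1 - x = 0), or_assoc]
  refine or_congr ?_ (or_congr ?_ Iff.rfl)
  · constructor <;> intro h <;> linarith
  · constructor <;> intro h <;> linarith

/-- The spectrum of the level-`n` Laplacian of the Fabrykowski–Gupta group:
`spec Δ₀ = {4}`, `spec Δ₁ = {1,4}`, and for `n ≥ 2`,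
`spec Δ_n = {1,4} ∪ ⋃_{m=2}^{n} {1 ± √(5−θ) : θ ∈ X_m}`. -/
theorem fabrykowski_gupta_spectrum :
    spectrum ℝ (fgDelta 0) = {4} ∧
    spectrum ℝ (fgDelta 1) = {1, 4} ∧
    (∀ n : ℕ, 2 ≤ n →
      spectrum ℝ (fgDelta n) =
        {x : ℝ | x = 1 ∨ x = 4 ∨ ∃ m : ℕ, 2 ≤ m ∧ m ≤ n ∧ ∃ θ ∈ Xset m,
          x = 1 + Real.sqrt (5 - θ) ∨ x = 1 - Real.sqrt (5 - θ)}) := by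
  refine ⟨?_, ?_, ?_⟩
  · ext x
    have hS : fgS 0 = id := rfl
    have hA : fgA 0 = id := rfl
    rw [mem_spectrum_fgDelta_iff, Matrix.det_unique]
    simp [fgPencil, fgAdjS, fgAdjA, permMat, hS, hA]
    constructor <;> intro h <;> linarith
  · ext x
    rw [mem_spectrum_fgDelta_succ_iff 0]
    simp only [Set.mem_insert_iff, Set.mem_singleton_iff]
    refine or_congr Iff.rfl (or_iff_left ?_)
    rintro ⟨m, hm, hm', -⟩
    omega
  · intro n hn
    obtain ⟨k, rfl⟩ := Nat.exists_eq_add_of_le' (one_le_two.trans hn)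
    ext x
    rw [mem_spectrum_fgDelta_succ_iff, Set.mem_ofPred_eq]
    constructor
    · rintro (h | h | ⟨m, hm, hm', hX⟩)
      · exact Or.inl h
      · exact Or.inr (Or.inl h)
      · refine Or.inr (Or.inr ⟨m, hm, hm', _, hX, ?_⟩)
        rw [show 5 - (4 + 2 * x - x ^ 2) = (x - 1) ^ 2 by ring, Real.sqrt_sq_eq_abs]
        rcases abs_choice (x - 1) with h | h <;> rw [h]
        · left; ring
        · right; ring
    · rintro (h | h | ⟨m, hm, hm', θ, hθ, hx⟩)
      · exact Or.inl h
      · exact Or.inr (Or.inl h)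
      · rcases le_total 0 (5 - θ) with h5 | h5
        · refine Or.inr (Or.inr ⟨m, hm, hm', ?_⟩)
          have hsq := Real.sq_sqrt h5
          convert hθ using 1
          rcases hx with rfl | rfl <;> linear_combination -hsq
        · rw [Real.sqrt_eq_zero_of_nonpos h5] at hx
          left
          rcases hx with rfl | rfl <;> norm_num
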